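/- Let V ⊂ Z^N be a positive circular subset with |V| = N and E a canonical basis adapted to V, and suppose that: the coefficient map v ↦ e_v is not injective; v·v ≤ -2 for each v ∈ V; and ∑_{v∈D}(v·v+2) = -|D| for each connected component D of V. Then for each e ∈ E not in the image of the coefficient map there exists u ∈ V with u = e_u - e, and u is the unique element of V with u·e ≠ 0 (indeed u·e = 1). Moreover, if C is the connected component of V containing u, then: if |C| > 3 there exists v ∈ C with v·e_u = 1 such that v·f ≠ 0 for at least 3 distinct elements f ∈ E; if |C| = 3 then C = { e_1 - e_2, e_3 - e_1, -2e_3 - e_1 } for some e_1, e_2, e_3 ∈ E. -/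

import Mathlib

open Finset

/-- The standard negative definite bilinear form on `ℤ^N`:
`x·y = -∑ i, x i * y i`. -/
def negForm (N : ℕ) (u v : Fin N → ℤ) : ℤ := -∑ i, u i * v i

/-- A canonical basis of `ℤ^N`: a set of `N` vectors with `e·e = -1` and
distinct elements pairwise orthogonal. -/
def IsCanonicalBasis (N : ℕ) (E : Finset (Fin N → ℤ)) : Prop :=
  E.card = N ∧ (∀ e ∈ E, negForm N e e = -1) ∧
    ∀ e ∈ E, ∀ f ∈ E, e ≠ f → negForm N e f = 0

/-- The equivalence relation on `ℤ^N` generated by `u ~ v` iff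
`u, v ∈ V` and `u·v ≠ 0`. -/
def Conn (N : ℕ) (V : Finset (Fin N → ℤ)) : (Fin N → ℤ) → (Fin N → ℤ) → Prop :=
  Relation.EqvGen fun u v => u ∈ V ∧ v ∈ V ∧ negForm N u v ≠ 0

open scoped Classical in
/-- The connected component of `v` in `V`. -/
noncomputable def compOf (N : ℕ) (V : Finset (Fin N → ℤ)) (v : Fin N → ℤ) :
    Finset (Fin N → ℤ) :=
  V.filter fun u => Conn N V u v

/-- A circular subset of `ℤ^N`. -/
def IsCircular (N : ℕ) (V : Finset (Fin N → ℤ)) : Prop :=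
  (∀ v ∈ V, 3 ≤ (compOf N V v).card) ∧
  (∀ u ∈ V, ∀ v ∈ V, u ≠ v →
    negForm N u v = -1 ∨ negForm N u v = 0 ∨ negForm N u v = 1) ∧
  (∀ v ∈ V,
    (V.filter fun u => u ≠ v ∧ (negForm N u v = 1 ∨ negForm N u v = -1)).card = 2)

/-- `E` is a canonical basis adapted to `V`:  `∑_{v ∈ V} v = -∑_{e ∈ E} e`. -/
def IsAdaptedBasis (N : ℕ) (E V : Finset (Fin N → ℤ)) : Prop :=
  IsCanonicalBasis N E ∧ (∑ v ∈ V, v) = -∑ e ∈ E, e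

open scoped Classical in
/-- A semipositive circular subset: each connected component contains exactly one
(unordered) pair of distinct vectors `u, v` with `u·v = -1`. -/
def IsSemipositive (N : ℕ) (V : Finset (Fin N → ℤ)) : Prop :=
  IsCircular N V ∧ ∀ v₀ ∈ V,
    (((compOf N V v₀) ×ˢ (compOf N V v₀)).filter fun p =>
      p.1 ≠ p.2 ∧ negForm N p.1 p.2 = -1).card = 2

/-- A positive circular subset: `u·v ≥ 0` for all distinct `u, v ∈ V`. -/
def IsPositive (N : ℕ) (V : Finset (Fin N → ℤ)) : Prop :=
  IsCircular N V ∧ ∀ u ∈ V, ∀ v ∈ V, u ≠ v → 0 ≤ negForm N u v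

/-- A single blowup of a string of nonnegative integers. -/
inductive IsBlowup : List ℕ → List ℕ → Prop
  | left (a b : ℕ) (m : List ℕ) :
      IsBlowup (a :: (m ++ [b])) (1 :: (a + 1) :: (m ++ [b + 1]))
  | middle (a b : ℕ) (p s : List ℕ) :
      IsBlowup (p ++ a :: b :: s) (p ++ (a + 1) :: 1 :: (b + 1) :: s)
  | right (a b : ℕ) (m : List ℕ) :
      IsBlowup (a :: (m ++ [b])) ((a + 1) :: (m ++ [b + 1, 1]))

/-- An iterated blowup of `(0,0)`. -/
def IsIteratedBlowup (s : List ℕ) : Prop :=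
  Relation.ReflTransGen IsBlowup [0, 0] s

/-- A `(-2)`-expansion of a string of negative integers. -/
inductive IsNeg2Expansion : List ℤ → List ℤ → Prop
  | first (l : List ℤ) (a : ℤ) :
      IsNeg2Expansion (-2 :: (l ++ [a])) (-2 :: -2 :: (l ++ [a - 1]))
  | second (a : ℤ) (l : List ℤ) :
      IsNeg2Expansion (-2 :: a :: l) (-2 :: (a - 1) :: (l ++ [-2]))

/-- A cyclic listing of (the elements of) a connected component `C` of a circular
subset: a cyclically indexed enumeration of `C` in which consecutive elements
pair to `±1`. -/
def IsCyclicListing (N : ℕ) (C : Finset (Fin N → ℤ)) (m : ℕ)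
    (w : ZMod m → (Fin N → ℤ)) : Prop :=
  C.card = m ∧ Function.Injective w ∧ (∀ i, w i ∈ C) ∧ (∀ c ∈ C, ∃ i, w i = c) ∧
    ∀ i : ZMod m, negForm N (w i) (w (i + 1)) = 1 ∨ negForm N (w i) (w (i + 1)) = -1

/-- The index in the cyclic string at which the `i`-th block starts. -/
def blockStart {t : ℕ} (y : Fin t → ℕ) (i : Fin t) : ℕ := ∑ i' ∈ Finset.Iio i, y i'

/-- The string of squares `(-x₁-2, -2,…,-2, …, -xₜ-2, -2,…,-2)` of the lattice
`Λ_Γ`, as a function on `Fin n` (where `n = ∑ yᵢ`). -/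
def sqOf {t : ℕ} (x y : Fin t → ℕ) (n : ℕ) (j : Fin n) : ℤ :=
  -2 - ∑ i : Fin t, if (j : ℕ) = blockStart y i then (x i : ℤ) else 0

/-- The Gram matrix of the lattice `Λ_Γ`: diagonal given by `sq`, consecutive
vertices pair to `1`, the last and first vertices pair to `(-1)^d`, all other
pairs are orthogonal. -/
def gramOf (n : ℕ) (sq : Fin n → ℤ) (d : ℕ) (i j : Fin n) : ℤ :=
  if i = j then sq i
  else if (j : ℕ) = (i : ℕ) + 1 ∨ (i : ℕ) = (j : ℕ) + 1 then 1
  else if ((i : ℕ) = 0 ∧ (j : ℕ) = n - 1) ∨ ((j : ℕ) = 0 ∧ (i : ℕ) = n - 1)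
    then (-1) ^ d
  else 0

section Bilinear

variable {N : ℕ}

theorem negForm_eq_neg_dotProduct (u v : Fin N → ℤ) : negForm N u v = -(u ⬝ᵥ v) := rfl

theorem negForm_comm (u v : Fin N → ℤ) : negForm N u v = negForm N v u := by
  simp only [negForm_eq_neg_dotProduct, dotProduct_comm]

theorem negForm_sub_right (u v w : Fin N → ℤ) :
    negForm N u (v - w) = negForm N u v - negForm N u w := by
  simp only [negForm_eq_neg_dotProduct, dotProduct_sub]; ring

theorem negForm_neg_right (u v : Fin N → ℤ) : negForm N u (-v) = -negForm N u v := by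
  simp only [negForm_eq_neg_dotProduct, dotProduct_neg]

theorem negForm_smul_right (u v : Fin N → ℤ) (k : ℤ) :
    negForm N u (k • v) = k * negForm N u v := by
  simp only [negForm_eq_neg_dotProduct, dotProduct_smul, smul_eq_mul]; ring

theorem negForm_sum_right {ι : Type*} (u : Fin N → ℤ) (s : Finset ι) (g : ι → Fin N → ℤ) :
    negForm N u (∑ i ∈ s, g i) = ∑ i ∈ s, negForm N u (g i) := by
  simp only [negForm_eq_neg_dotProduct, dotProduct_sum, Finset.sum_neg_distrib]

variable {E : Finset (Fin N → ℤ)}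

theorem IsCanonicalBasis.sum_mul_eq_ite (hE : IsCanonicalBasis N E) (i j : Fin N) :
    ∑ f ∈ E, f i * f j = if i = j then 1 else 0 := by
  obtain ⟨hc, h1, h0⟩ := hE
  let M : Matrix E (Fin N) ℤ := fun f i => f.1 i
  have hM : M * M.transpose = 1 := by
    ext f g
    rw [Matrix.mul_apply, Matrix.one_apply]
    split_ifs with hfg
    · subst hfg
      have := h1 f.1 f.2
      simp only [negForm] at this
      change ∑ k, f.1 k * f.1 k = _
      linarith
    · have := h0 f.1 f.2 g.1 g.2 (fun h => hfg (Subtype.ext h))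
      simp only [negForm] at this
      change ∑ k, f.1 k * g.1 k = _
      linarith
  have hM' : M.transpose * M = 1 :=
    (Matrix.mul_eq_one_comm_of_card_eq _ _ _ (by simp [hc])).1 hM
  have := congrFun (congrFun hM' i) j
  rw [Matrix.mul_apply, Matrix.one_apply] at this
  rw [← this, ← Finset.sum_coe_sort]
  rfl

theorem IsCanonicalBasis.eq_neg_sum (hE : IsCanonicalBasis N E) (x : Fin N → ℤ) :
    x = -∑ f ∈ E, negForm N x f • f := by
  ext i
  simp only [negForm, Pi.neg_apply, Finset.sum_apply, Pi.smul_apply, smul_eq_mul, neg_mul,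
    Finset.sum_neg_distrib, neg_neg, Finset.sum_mul, mul_assoc]
  rw [Finset.sum_comm]
  simp only [← Finset.mul_sum, hE.sum_mul_eq_ite]
  simp

theorem IsCanonicalBasis.negForm_eq (hE : IsCanonicalBasis N E) (x y : Fin N → ℤ) :
    negForm N x y = -∑ f ∈ E, negForm N x f * negForm N y f := by
  conv_lhs => rw [hE.eq_neg_sum y]
  rw [negForm_neg_right, negForm_sum_right]
  simp only [negForm_smul_right, mul_comm]

theorem IsCanonicalBasis.ext (hE : IsCanonicalBasis N E) {x y : Fin N → ℤ}
    (h : ∀ f ∈ E, negForm N x f = negForm N y f) : x = y := by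
  rw [hE.eq_neg_sum x, hE.eq_neg_sum y, Finset.sum_congr rfl fun f hf => by rw [h f hf]]

end Bilinear

section Coefficients

variable {N : ℕ} {V E : Finset (Fin N → ℤ)}

theorem IsPositive.sum_negForm (hV : IsPositive N V) {v : Fin N → ℤ} (hv : v ∈ V) :
    ∑ w ∈ V, negForm N v w = negForm N v v + 2 := by
  rw [← Finset.add_sum_erase V _ hv]
  congr 1
  have h2 := hV.1.2.2 v hv
  have key : ∀ w ∈ V.erase v, negForm N v w =
      if w ≠ v ∧ (negForm N w v = 1 ∨ negForm N w v = -1) then 1 else 0 := by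
    intro w hw
    obtain ⟨hwv, hw⟩ := Finset.mem_erase.1 hw
    have ha := hV.1.2.1 w hw v hv hwv
    have hb := hV.2 w hw v hv hwv
    rw [negForm_comm v w]
    split_ifs with h <;> grind
  rw [Finset.sum_congr rfl key, Finset.sum_boole]
  rw [show (2 : ℤ) = ((2 : ℕ) : ℤ) from rfl, ← h2]
  congr 2
  ext w
  simp only [Finset.mem_filter, Finset.mem_erase]
  tauto

/-- Every element of a positive circular subset has exactly one coefficient outside `{0, 1}`. -/
theorem IsPositive.exists_coefficient (hV : IsPositive N V) (hE : IsAdaptedBasis N E V)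
    {v : Fin N → ℤ} (hv : v ∈ V) :
    ∃ a ∈ E, (negForm N v a = -1 ∨ negForm N v a = 2) ∧
      ∀ f ∈ E, f ≠ a → negForm N v f = 0 ∨ negForm N v f = 1 := by
  have hsum : ∑ f ∈ E, negForm N v f * (negForm N v f - 1) = 2 := by
    have h1 := hV.sum_negForm hv
    rw [← negForm_sum_right, hE.2, negForm_neg_right, negForm_sum_right,
      hE.1.negForm_eq v v] at h1
    simp only [mul_sub, mul_one, Finset.sum_sub_distrib]
    linarith
  have hnn : ∀ f ∈ E, 0 ≤ negForm N v f * (negForm N v f - 1) := by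
    intro f _
    rcases le_or_gt (negForm N v f) 0 with h | h <;> nlinarith
  obtain ⟨a, ha, hane⟩ := Finset.exists_ne_zero_of_sum_ne_zero (hsum.trans_ne two_ne_zero)
  rw [← Finset.add_sum_erase E _ ha] at hsum
  have hrest : 0 ≤ ∑ f ∈ E.erase a, negForm N v f * (negForm N v f - 1) :=
    Finset.sum_nonneg fun f hf => hnn f (Finset.mem_of_mem_erase hf)
  have hval : negForm N v a = -1 ∨ negForm N v a = 2 := by
    generalize negForm N v a = x at *
    have h1 : -1 ≤ x := by nlinarith
    have h2 : x ≤ 2 := by nlinarith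
    interval_cases x <;> simp_all
  refine ⟨a, ha, hval, fun f hf hfa => ?_⟩
  have hz : ∑ f ∈ E.erase a, negForm N v f * (negForm N v f - 1) = 0 := by
    rcases hval with h | h <;> rw [h] at hsum <;> linarith
  have := (Finset.sum_eq_zero_iff_of_nonneg fun f hf => hnn f (Finset.mem_of_mem_erase hf)).1 hz f
    (Finset.mem_erase.2 ⟨hfa, hf⟩)
  rcases mul_eq_zero.1 this with h | h <;> omega

theorem IsAdaptedBasis.sum_negForm (hE : IsAdaptedBasis N E V) {f : Fin N → ℤ} (hf : f ∈ E) :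
    ∑ v ∈ V, negForm N v f = 1 := by
  simp only [negForm_comm _ f]
  rw [← negForm_sum_right, hE.2, negForm_neg_right, negForm_sum_right,
    Finset.sum_eq_single_of_mem f hf fun g hg hgf => hE.1.2.2 f hf g hg hgf.symm,
    hE.1.2.1 f hf, neg_neg]

theorem exists_relation_off (hcard : V.card = E.card) {e : Fin N → ℤ} (he : e ∈ E) :
    ∃ x : (Fin N → ℤ) → ℤ, (∀ f ∈ E, f ≠ e → ∑ v ∈ V, x v * negForm N v f = 0) ∧
      ∃ v ∈ V, x v ≠ 0 := by
  let g : V → (E.erase e → ℤ) := fun v f => negForm N v.1 f.1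
  have hdep : ¬ LinearIndependent ℤ g := by
    intro h
    have h1 := h.fintype_card_le_finrank
    have h2 := Finset.card_erase_lt_of_mem he
    rw [Module.finrank_fintype_fun_eq_card, Fintype.card_coe, Fintype.card_coe] at h1
    omega
  obtain ⟨y, hy, v, hv⟩ := Fintype.not_linearIndependent_iff.1 hdep
  refine ⟨fun v => if h : v ∈ V then y ⟨v, h⟩ else 0, fun f hf hfe => ?_, v.1, v.2, by simpa⟩
  have := congrFun hy ⟨f, Finset.mem_erase.2 ⟨hfe, hf⟩⟩
  rw [← Finset.sum_coe_sort]
  simpa [g, Finset.sum_apply] using this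

theorem Conn.map_eq {x : (Fin N → ℤ) → ℤ}
    (hx : ∀ v ∈ V, ∀ w ∈ V, negForm N v w ≠ 0 → x v = x w) {v w : Fin N → ℤ}
    (h : Conn N V v w) : x v = x w := by
  induction h with
  | rel _ _ h => exact hx _ h.1 _ h.2.1 h.2.2
  | refl => rfl
  | symm _ _ _ ih => exact ih.symm
  | trans _ _ _ _ _ ih₁ ih₂ => exact ih₁.trans ih₂

theorem mem_compOf {u v : Fin N → ℤ} : v ∈ compOf N V u ↔ v ∈ V ∧ Conn N V v u := by
  simp only [compOf, Finset.mem_filter]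

theorem mem_compOf_self {v : Fin N → ℤ} (hv : v ∈ V) : v ∈ compOf N V v :=
  mem_compOf.2 ⟨hv, Relation.EqvGen.refl v⟩

theorem mem_compOf_of_negForm_ne_zero {u v w : Fin N → ℤ} (hv : v ∈ compOf N V u) (hw : w ∈ V)
    (h : negForm N w v ≠ 0) : w ∈ compOf N V u :=
  mem_compOf.2 ⟨hw, .trans _ _ _ (.rel _ _ ⟨hw, (mem_compOf.1 hv).1, h⟩)
    (mem_compOf.1 hv).2⟩

theorem compOf_subset_of_closed {u : Fin N → ℤ} {T : Finset (Fin N → ℤ)} (hu : u ∈ T)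
    (hT : ∀ a ∈ T, ∀ b ∈ V, negForm N b a ≠ 0 → b ∈ T) : compOf N V u ⊆ T := by
  intro w hw
  have h := Conn.map_eq (x := fun v => if v ∈ T then 1 else 0) (fun v hv w hw hvw => by
    have h1 := hT v
    have h2 := hT w
    have := negForm_comm v w
    grind) (mem_compOf.1 hw).2
  by_contra hwT
  simp [hu, hwT] at h

/-- The key degeneracy argument: if a basis vector `e` pairs nontrivially only with `u`, then
projecting it away makes `V` linearly dependent, which forces `u` to have square `-2`. -/
theorem IsPositive.negForm_self_eq_neg_two (hV : IsPositive N V) (hE : IsAdaptedBasis N E V)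
    (hcard : V.card = N) (hsq : ∀ v ∈ V, negForm N v v ≤ -2)
    (hcomp : ∀ v ∈ V,
      (∑ u ∈ compOf N V v, (negForm N u u + 2)) = -((compOf N V v).card : ℤ))
    {u e : Fin N → ℤ} (hu : u ∈ V) (he : e ∈ E) (hue : negForm N u e = 1)
    (hw : ∀ w ∈ V, w ≠ u → negForm N w e = 0) : negForm N u u = -2 := by
  classical
  by_contra hne
  have hlt : negForm N u u ≤ -3 := by have := hsq u hu; omega
  obtain ⟨x, hx, v₀, hv₀, hxv₀⟩ := exists_relation_off (hcard.trans hE.1.1.symm) he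
  have hxe : ∑ v ∈ V, x v * negForm N v e = x u := by
    rw [Finset.sum_eq_single_of_mem u hu fun w hwV hwu => by rw [hw w hwV hwu, mul_zero], hue,
      mul_one]
  have hquad : ∑ v ∈ V, ∑ w ∈ V, x v * x w * negForm N v w = -(x u) ^ 2 := by
    have h1 : ∑ v ∈ V, ∑ w ∈ V, x v * x w * negForm N v w
        = -∑ f ∈ E, (∑ v ∈ V, x v * negForm N v f) * ∑ w ∈ V, x w * negForm N w f := by
      simp only [Finset.sum_mul_sum]
      rw [Finset.sum_comm (s := E), ← Finset.sum_neg_distrib]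
      refine Finset.sum_congr rfl fun v _ => ?_
      rw [Finset.sum_comm (s := E), ← Finset.sum_neg_distrib]
      refine Finset.sum_congr rfl fun w _ => ?_
      rw [hE.1.negForm_eq v w, mul_neg, Finset.mul_sum]
      exact congrArg _ (Finset.sum_congr rfl fun f _ => by ring)
    rw [h1, Finset.sum_eq_single_of_mem e he fun f hf hfe => by rw [hx f hf hfe, zero_mul], hxe]
    ring
  have hdiff : ∑ v ∈ V, ∑ w ∈ V, negForm N v w * (x v - x w) ^ 2
      = 2 * ∑ v ∈ V, (negForm N v v + 2 + if v = u then 1 else 0) * x v ^ 2 := by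
    have hrow : ∑ v ∈ V, ∑ w ∈ V, negForm N v w * x v ^ 2
        = ∑ v ∈ V, (negForm N v v + 2) * x v ^ 2 :=
      Finset.sum_congr rfl fun v hv => by rw [← Finset.sum_mul, hV.sum_negForm hv]
    have hcol : ∑ v ∈ V, ∑ w ∈ V, negForm N v w * x w ^ 2
        = ∑ v ∈ V, (negForm N v v + 2) * x v ^ 2 := by
      rw [Finset.sum_comm, ← hrow]
      exact Finset.sum_congr rfl fun v _ => Finset.sum_congr rfl fun w _ => by
        rw [negForm_comm]
    have hone : ∑ v ∈ V, (if v = u then (1 : ℤ) else 0) * x v ^ 2 = x u ^ 2 := by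
      simp [hu]
    have hexp : ∑ v ∈ V, ∑ w ∈ V, negForm N v w * (x v - x w) ^ 2
        = ∑ v ∈ V, ∑ w ∈ V, negForm N v w * x v ^ 2
          + ∑ v ∈ V, ∑ w ∈ V, negForm N v w * x w ^ 2
          - 2 * ∑ v ∈ V, ∑ w ∈ V, x v * x w * negForm N v w := by
      simp only [Finset.mul_sum, ← Finset.sum_add_distrib, ← Finset.sum_sub_distrib]
      exact Finset.sum_congr rfl fun v _ => Finset.sum_congr rfl fun w _ => by ring
    rw [hexp, hrow, hcol, hquad]
    simp only [add_mul _ (ite _ _ _), Finset.sum_add_distrib, hone]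
    ring
  have hterm : ∀ v ∈ V, ∀ w ∈ V, 0 ≤ negForm N v w * (x v - x w) ^ 2 := by
    intro v hv w hw
    rcases eq_or_ne v w with rfl | hvw
    · simp
    · exact mul_nonneg (hV.2 v hv w hw hvw) (sq_nonneg _)
  have hdiag : ∀ v ∈ V, (negForm N v v + 2 + if v = u then 1 else 0) * x v ^ 2 ≤ 0 := by
    intro v hv
    refine mul_nonpos_of_nonpos_of_nonneg ?_ (sq_nonneg _)
    have := hsq v hv
    split_ifs with h
    · subst h; omega
    · omega
  have hL := Finset.sum_nonneg fun v hv => Finset.sum_nonneg (hterm v hv)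
  have hR := Finset.sum_nonpos hdiag
  have hL0 : ∑ v ∈ V, ∑ w ∈ V, negForm N v w * (x v - x w) ^ 2 = 0 := by linarith
  have hR0 : ∑ v ∈ V, (negForm N v v + 2 + if v = u then 1 else 0) * x v ^ 2 = 0 := by linarith
  have hconst : ∀ v ∈ V, ∀ w ∈ V, negForm N v w ≠ 0 → x v = x w := by
    intro v hv w hw hvw
    have h1 := (Finset.sum_eq_zero_iff_of_nonneg
      fun v hv => Finset.sum_nonneg (hterm v hv)).1 hL0 v hv
    have h2 := (Finset.sum_eq_zero_iff_of_nonneg (hterm v hv)).1 h1 w hw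
    exact sub_eq_zero.1 (pow_eq_zero_iff two_ne_zero |>.1 ((mul_eq_zero.1 h2).resolve_left hvw))
  have hzero : ∀ v ∈ compOf N V v₀, negForm N v v + 2 = -if v = u then 1 else 0 := by
    intro v hv
    obtain ⟨hvV, hconn⟩ := mem_compOf.1 hv
    have h1 := (Finset.sum_eq_zero_iff_of_nonpos hdiag).1 hR0 v hvV
    rw [Conn.map_eq hconst hconn] at h1
    have := (mul_eq_zero.1 h1).resolve_right (pow_ne_zero 2 hxv₀)
    omega
  have hD := hcomp v₀ hv₀
  rw [Finset.sum_congr rfl hzero, Finset.sum_neg_distrib, Finset.sum_ite_eq'] at hD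
  have h3 := hV.1.1 v₀ hv₀
  split_ifs at hD <;> omega

end Coefficients

section Triangle

/-- The two possible shapes of a pair of coefficient vectors `p`, `q` with pairing `-1` whose
squares sum to `7`, each having a single coefficient outside `{0, 1}`. -/
theorem triangle_coefficients {α : Type*} {E : Finset α} {p q : α → ℤ} {a b c : α}
    (ha : a ∈ E) (hb : b ∈ E) (hc : c ∈ E) (hac : a ≠ c) (hbc : b ≠ c)
    (hpc : p c = 1) (hqc : q c = 1) (hpa : p a = -1 ∨ p a = 2) (hqb : q b = -1 ∨ q b = 2)
    (hp : ∀ f ∈ E, f ≠ a → p f = 0 ∨ p f = 1) (hq : ∀ f ∈ E, f ≠ b → q f = 0 ∨ q f = 1)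
    (hpq : ∑ f ∈ E, p f * q f = -1) (hsq : ∑ f ∈ E, (p f ^ 2 + q f ^ 2) = 7) :
    (a = b ∧ (p a = -1 ∧ q a = 2 ∨ p a = 2 ∧ q a = -1) ∧
      ∀ f ∈ E, f ≠ c → f ≠ a → p f = 0 ∧ q f = 0) ∨
    (a ≠ b ∧ p a = -1 ∧ p b = 1 ∧ q a = 1 ∧ q b = -1 ∧
      ∃ d ∈ E, d ≠ a ∧ d ≠ b ∧ d ≠ c ∧ (p d = 0 ∧ q d = 1 ∨ p d = 1 ∧ q d = 0) ∧
        ∀ f ∈ E, f ≠ a → f ≠ b → f ≠ c → f ≠ d → p f = 0 ∧ q f = 0) := by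
  classical
  have hsq0 : ∀ x y : ℤ, 0 ≤ x ^ 2 + y ^ 2 := fun x y => by positivity
  have hzero : ∀ x y : ℤ, x ^ 2 + y ^ 2 = 0 → x = 0 ∧ y = 0 := fun x y h => by
    constructor <;> nlinarith [sq_nonneg x, sq_nonneg y]
  rw [← Finset.add_sum_erase E _ hc, ← Finset.add_sum_erase _ _ (Finset.mem_erase.2 ⟨hac, ha⟩)]
    at hpq hsq
  rw [hpc, hqc] at hpq hsq
  by_cases hab : a = b
  · subst hab
    have hnn : 0 ≤ ∑ f ∈ (E.erase c).erase a, p f * q f := Finset.sum_nonneg fun f hf => by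
      simp only [Finset.mem_erase] at hf
      have := hp f hf.2.2 hf.1
      have := hq f hf.2.2 hf.1
      grind
    have hval : p a = -1 ∧ q a = 2 ∨ p a = 2 ∧ q a = -1 := by
      rcases hpa with h | h <;> rcases hqb with h' | h' <;> rw [h, h'] at hpq <;> first
        | (exfalso; linarith)
        | simp [h, h']
    have hS : ∑ f ∈ (E.erase c).erase a, (p f ^ 2 + q f ^ 2) = 0 := by
      rcases hval with ⟨h, h'⟩ | ⟨h, h'⟩ <;> rw [h, h'] at hsq <;> linarith
    rw [Finset.sum_eq_zero_iff_of_nonneg fun _ _ => hsq0 _ _] at hS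
    exact .inl ⟨rfl, hval, fun f hf hfc hfa => hzero _ _ (hS f (by simp [*]))⟩
  · rw [← Finset.add_sum_erase ((E.erase c).erase a) _ (a := b) (by simp [*, Ne.symm hab])]
      at hpq hsq
    set R := ((E.erase c).erase a).erase b with hR
    have hmem : ∀ {f}, f ∈ R ↔ f ≠ b ∧ f ≠ a ∧ f ≠ c ∧ f ∈ E := by simp [hR]
    have hnn : ∀ f ∈ R, 0 ≤ p f * q f := fun f hf => by
      obtain ⟨h1, h2, h3, h4⟩ := hmem.1 hf
      have := hp f h4 h2
      have := hq f h4 h1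
      grind
    have hS := Finset.sum_nonneg hnn
    have hvals : p a = -1 ∧ p b = 1 ∧ q a = 1 ∧ q b = -1 := by
      rcases hpa with h | h <;> rcases hqb with h' | h' <;>
      rcases hp b hb (Ne.symm hab) with h1 | h1 <;> rcases hq a ha hab with h2 | h2 <;>
      rw [h, h', h1, h2] at hpq <;> first
        | (exfalso; linarith)
        | simp [h, h', h1, h2]
    obtain ⟨h1, h2, h3, h4⟩ := hvals
    rw [h1, h2, h3, h4] at hpq hsq
    have hS0 : ∑ f ∈ R, p f * q f = 0 := by linarith
    have hS1 : ∑ f ∈ R, (p f ^ 2 + q f ^ 2) = 1 := by linarith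
    rw [Finset.sum_eq_zero_iff_of_nonneg hnn] at hS0
    obtain ⟨d, hd, hd0⟩ := Finset.exists_ne_zero_of_sum_ne_zero (hS1.trans_ne one_ne_zero)
    obtain ⟨hdb, hda, hdc, hdE⟩ := hmem.1 hd
    have hdv : p d = 0 ∧ q d = 1 ∨ p d = 1 ∧ q d = 0 := by
      have := hS0 d hd
      have := hp d hdE hda
      have := hq d hdE hdb
      grind
    rw [← Finset.add_sum_erase R _ hd] at hS1
    have hS2 : ∑ f ∈ R.erase d, (p f ^ 2 + q f ^ 2) = 0 := by
      rcases hdv with ⟨h, h'⟩ | ⟨h, h'⟩ <;> rw [h, h'] at hS1 <;> linarith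
    rw [Finset.sum_eq_zero_iff_of_nonneg fun _ _ => hsq0 _ _] at hS2
    exact .inr ⟨hab, h1, h2, h3, h4, d, hdE, hda, hdb, hdc, hdv, fun f hf hfa hfb hfc hfd =>
      hzero _ _ (hS2 f (Finset.mem_erase.2 ⟨hfd, hmem.2 ⟨hfb, hfa, hfc, hf⟩⟩))⟩

end Triangle

section Neighbors

variable {N : ℕ} {V E : Finset (Fin N → ℤ)}

theorem IsPositive.exists_neighbors (hV : IsPositive N V) {u : Fin N → ℤ} (hu : u ∈ V) :
    ∃ v₁ ∈ V, ∃ v₂ ∈ V, v₁ ≠ v₂ ∧ v₁ ≠ u ∧ v₂ ≠ u ∧ negForm N v₁ u = 1 ∧ negForm N v₂ u = 1 ∧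
      ∀ w ∈ V, w ≠ u → w ≠ v₁ → w ≠ v₂ → negForm N w u = 0 := by
  obtain ⟨v₁, v₂, hne, hfil⟩ := Finset.card_eq_two.1 (hV.1.2.2 u hu)
  have hmem : ∀ w, (w ∈ V ∧ w ≠ u ∧ (negForm N w u = 1 ∨ negForm N w u = -1)) ↔
      w = v₁ ∨ w = v₂ := fun w => by simpa using Finset.ext_iff.1 hfil w
  obtain ⟨h1, h1u, h1'⟩ := (hmem v₁).2 (.inl rfl)
  obtain ⟨h2, h2u, h2'⟩ := (hmem v₂).2 (.inr rfl)
  have p1 := hV.2 v₁ h1 u hu h1u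
  have p2 := hV.2 v₂ h2 u hu h2u
  refine ⟨v₁, h1, v₂, h2, hne, h1u, h2u, by omega, by omega, fun w hw hwu hw1 hw2 => ?_⟩
  have := hV.1.2.1 w hw u hu hwu
  have := hmem w
  grind

/-- An element adjacent to both `u` and `v` has no further neighbours. -/
theorem IsPositive.negForm_eq_zero_of_adjacent (hV : IsPositive N V) {u v x w : Fin N → ℤ}
    (hx : x ∈ V) (hu : u ∈ V) (hv : v ∈ V) (hw : w ∈ V) (huv : u ≠ v) (hux : u ≠ x)
    (hvx : v ≠ x) (h1 : negForm N u x ≠ 0) (h2 : negForm N v x ≠ 0) (hwx : w ≠ x)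
    (hwu : w ≠ u) (hwv : w ≠ v) : negForm N w x = 0 := by
  obtain ⟨v₁, _, v₂, _, _, _, _, _, _, h⟩ := hV.exists_neighbors hx
  have := h u hu hux
  have := h v hv hvx
  have := h w hw hwx
  grind

theorem IsCanonicalBasis.negForm_mem (hE : IsCanonicalBasis N E) {e f : Fin N → ℤ} (he : e ∈ E)
    (hf : f ∈ E) : negForm N e f = if f = e then -1 else 0 := by
  split_ifs with h
  · rw [h, hE.2.1 e he]
  · exact hE.2.2 e he f hf (Ne.symm h)

theorem negForm_sub_left (u v w : Fin N → ℤ) :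
    negForm N (u - v) w = negForm N u w - negForm N v w := by
  rw [negForm_comm, negForm_sub_right, negForm_comm w, negForm_comm w]

theorem negForm_smul_left (u v : Fin N → ℤ) (k : ℤ) :
    negForm N (k • u) v = k * negForm N u v := by
  rw [negForm_comm, negForm_smul_right, negForm_comm]

theorem IsPositive.eq_sub_of_isolated (hV : IsPositive N V) (hE : IsAdaptedBasis N E V)
    (hcard : V.card = N) (hsq : ∀ v ∈ V, negForm N v v ≤ -2)
    (hcomp : ∀ v ∈ V,
      (∑ u ∈ compOf N V v, (negForm N u u + 2)) = -((compOf N V v).card : ℤ))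
    {u e : Fin N → ℤ} (hu : u ∈ V) (he : e ∈ E) (hue : negForm N u e = 1)
    (hw : ∀ w ∈ V, w ≠ u → negForm N w e = 0) : ∃ a ∈ E, a ≠ e ∧ u = a - e := by
  have h2 := hV.negForm_self_eq_neg_two hE hcard hsq hcomp hu he hue hw
  obtain ⟨a, ha, hval, -⟩ := hV.exists_coefficient hE hu
  have hae : a ≠ e := by rintro rfl; omega
  refine ⟨a, ha, hae, hE.1.ext fun f hf => ?_⟩
  rw [hE.1.negForm_eq, ← Finset.add_sum_erase E _ he,
    ← Finset.add_sum_erase _ _ (Finset.mem_erase.2 ⟨hae, ha⟩), hue] at h2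
  have hnn := Finset.sum_nonneg fun f (_ : f ∈ (E.erase e).erase a) =>
    mul_self_nonneg (negForm N u f)
  have hva : negForm N u a = -1 := by
    rcases hval with h | h
    · exact h
    · rw [h] at h2; linarith
  rw [hva] at h2
  have h0 : ∑ f ∈ (E.erase e).erase a, negForm N u f * negForm N u f = 0 := by linarith
  rw [Finset.sum_eq_zero_iff_of_nonneg fun _ _ => mul_self_nonneg _] at h0
  rw [negForm_sub_left, hE.1.negForm_mem ha hf, hE.1.negForm_mem he hf]
  have := h0 f
  simp only [Finset.mem_erase, mul_self_eq_zero] at this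
  grind

theorem negForm_eq_zero_of_card_support_lt {v a b : Fin N → ℤ} (ha : a ∈ E) (hb : b ∈ E)
    (hab : a ≠ b) (hva : negForm N v a ≠ 0) (hvb : negForm N v b ≠ 0)
    (hlt : (E.filter fun f => negForm N v f ≠ 0).card < 3) :
    ∀ f ∈ E, f ≠ a → f ≠ b → negForm N v f = 0 := by
  intro f hf hfa hfb
  by_contra hvf
  have hsub : {a, b, f} ⊆ E.filter fun f => negForm N v f ≠ 0 := by
    intro g hg
    simp only [Finset.mem_insert, Finset.mem_singleton] at hg
    grind
  have := Finset.card_le_card hsub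
  rw [Finset.card_eq_three.2 ⟨a, b, f, hab, hfa.symm, hfb.symm, rfl⟩] at this
  omega

end Neighbors

section Components

variable {N : ℕ} {V E : Finset (Fin N → ℤ)}

/-- Two orthogonal vectors sharing the coefficient `1` at `c` cannot both have support of size
two, if their remaining coefficient is `-1` or `2`. -/
theorem three_le_card_support_of_orthogonal (hE : IsCanonicalBasis N E) {v w a b c : Fin N → ℤ}
    (ha : a ∈ E) (hb : b ∈ E) (hc : c ∈ E) (hac : a ≠ c) (hbc : b ≠ c)
    (hva : negForm N v a = -1 ∨ negForm N v a = 2) (hwb : negForm N w b = -1 ∨ negForm N w b = 2)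
    (hvc : negForm N v c = 1) (hwc : negForm N w c = 1) (hvw : negForm N v w = 0) :
    3 ≤ (E.filter fun f => negForm N v f ≠ 0).card ∨
      3 ≤ (E.filter fun f => negForm N w f ≠ 0).card := by
  by_contra! h
  have hv := negForm_eq_zero_of_card_support_lt hc ha hac.symm (by omega) (by omega) h.1
  have hw := negForm_eq_zero_of_card_support_lt hc hb hbc.symm (by omega) (by omega) h.2
  rw [hE.negForm_eq, ← Finset.add_sum_erase E _ hc, Finset.sum_eq_single_of_mem a
    (Finset.mem_erase.2 ⟨hac, ha⟩) fun f hf hfa => by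
      rw [hv f (Finset.mem_of_mem_erase hf) (Finset.ne_of_mem_erase hf) hfa, zero_mul],
    hvc, hwc] at hvw
  by_cases hab : a = b
  · subst hab
    rcases hva with h1 | h1 <;> rcases hwb with h2 | h2 <;> rw [h1, h2] at hvw <;> omega
  · rw [hw a ha hac hab] at hvw
    omega

/-- A component `{u, v, w}` cannot have `v = a - b - c` and `w = b - a - c - d` when `c` pairs
trivially with all other elements of `V` and `u` is orthogonal to `d`. -/
theorem IsPositive.triangle_excluded (hV : IsPositive N V) (hE : IsAdaptedBasis N E V)
    (hcard : V.card = N) (hsq : ∀ v ∈ V, negForm N v v ≤ -2)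
    (hcomp : ∀ v ∈ V,
      (∑ u ∈ compOf N V v, (negForm N u u + 2)) = -((compOf N V v).card : ℤ))
    {u v w a b c d : Fin N → ℤ} (hw : w ∈ V)
    (ha : a ∈ E) (hb : b ∈ E) (hc : c ∈ E) (hd : d ∈ E) (hab : a ≠ b) (hac : a ≠ c) (hbc : b ≠ c)
    (hda : d ≠ a) (hdb : d ≠ b) (hdc : d ≠ c)
    (hxc : ∀ x ∈ V, x ≠ u → x ≠ v → x ≠ w → negForm N x c = 0)
    (hxv : ∀ x ∈ V, x ≠ u → x ≠ v → x ≠ w → negForm N x v = 0)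
    (hxw : ∀ x ∈ V, x ≠ u → x ≠ v → x ≠ w → negForm N x w = 0)
    (hud : negForm N u d = 0)
    (hva : negForm N v a = -1) (hvb : negForm N v b = 1)
    (hvd : negForm N v d = 0)
    (hwa : negForm N w a = 1) (hwb : negForm N w b = -1) (hwc : negForm N w c = 1)
    (hwd : negForm N w d = 1)
    (hrest : ∀ f ∈ E, f ≠ a → f ≠ b → f ≠ c → f ≠ d → negForm N v f = 0 ∧ negForm N w f = 0) :
    False := by
  have hexp : ∀ x y : Fin N → ℤ,
      (∀ f ∈ E, f ≠ a → f ≠ b → f ≠ c → f ≠ d → negForm N y f = 0) →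
      negForm N x y = -(negForm N x a * negForm N y a + negForm N x b * negForm N y b +
        negForm N x c * negForm N y c + negForm N x d * negForm N y d) := by
    intro x y hy
    rw [hE.1.negForm_eq, ← Finset.add_sum_erase E _ ha,
      ← Finset.add_sum_erase (E.erase a) _ (a := b) (by simp [*, Ne.symm hab]),
      ← Finset.add_sum_erase ((E.erase a).erase b) _ (a := c)
        (by simp [*, Ne.symm hac, Ne.symm hbc]),
      Finset.sum_eq_single_of_mem d (by simp [*]) fun f hf hfd => ?_]
    · ring
    · simp only [Finset.mem_erase] at hf
      rw [hy f hf.2.2.2 hf.2.2.1 hf.2.1 hf.1 hfd, mul_zero]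
  have hxd : ∀ x ∈ V, x ≠ w → negForm N x d = 0 := by
    intro x hx hxw'
    by_cases hxu : x = u
    · rw [hxu, hud]
    by_cases hxv' : x = v
    · rw [hxv', hvd]
    have h1 := hxc x hx hxu hxv' hxw'
    have h2 := hxv x hx hxu hxv' hxw'
    have h3 := hxw x hx hxu hxv' hxw'
    rw [hexp x v fun f hf h1 h2 h3 h4 => (hrest f hf h1 h2 h3 h4).1, h1, hva, hvb, hvd] at h2
    rw [hexp x w fun f hf h1 h2 h3 h4 => (hrest f hf h1 h2 h3 h4).2, h1, hwa, hwb, hwd] at h3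
    linarith
  have h2 := hV.negForm_self_eq_neg_two hE hcard hsq hcomp hw hd hwd hxd
  rw [hexp w w fun f hf h1 h2 h3 h4 => (hrest f hf h1 h2 h3 h4).2, hwa, hwb, hwc, hwd] at h2
  omega

end Components

/-- positive circular subsets whose coefficient map is not
injective: structure of the vectors hitting a basis vector `e` not in the image
of the coefficient map, and of the connected component containing them. -/
theorem stmt_12 (N : ℕ) (V E : Finset (Fin N → ℤ))
    (hpos : IsPositive N V) (hcard : V.card = N)
    (hE : IsAdaptedBasis N E V)
    (hninj : ∃ v ∈ V, ∃ v' ∈ V, v ≠ v' ∧ ∃ e ∈ E,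
      (negForm N v e = -1 ∨ negForm N v e = 2) ∧
      (negForm N v' e = -1 ∨ negForm N v' e = 2))
    (hsq : ∀ v ∈ V, negForm N v v ≤ -2)
    (hcomp : ∀ v ∈ V,
      (∑ u ∈ compOf N V v, (negForm N u u + 2)) = -((compOf N V v).card : ℤ)) :
    ∀ e ∈ E,
      (∀ v ∈ V, ¬(negForm N v e = -1 ∨ negForm N v e = 2)) →
      ∃ u ∈ V, ∃ eu ∈ E,
        (negForm N u eu = -1 ∨ negForm N u eu = 2) ∧
        u = eu - e ∧ negForm N u e = 1 ∧
        (∀ w ∈ V, negForm N w e ≠ 0 → w = u) ∧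
        (3 < (compOf N V u).card →
          ∃ v ∈ compOf N V u, negForm N v eu = 1 ∧
            3 ≤ (E.filter fun f => negForm N v f ≠ 0).card) ∧
        ((compOf N V u).card = 3 →
          ∃ e1 ∈ E, ∃ e2 ∈ E, ∃ e3 ∈ E,
            compOf N V u = {e1 - e2, e3 - e1, (-2 : ℤ) • e3 - e1}) := by
  intro e he hnot
  have hcol : ∀ v ∈ V, negForm N v e = 0 ∨ negForm N v e = 1 := fun v hv => by
    obtain ⟨a, _, hval, h⟩ := hpos.exists_coefficient hE hv
    exact h e he fun h => hnot v hv (h ▸ hval)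
  have hsum := hE.sum_negForm he
  obtain ⟨u, hu, hue0⟩ := Finset.exists_ne_zero_of_sum_ne_zero (hsum.trans_ne one_ne_zero)
  have hue : negForm N u e = 1 := (hcol u hu).resolve_left hue0
  have hwe : ∀ w ∈ V, w ≠ u → negForm N w e = 0 := by
    rw [← Finset.add_sum_erase V _ hu, hue, add_eq_left, Finset.sum_eq_zero_iff_of_nonneg
      fun w hw => by have := hcol w (Finset.mem_of_mem_erase hw); omega] at hsum
    exact fun w hw hwu => hsum w (Finset.mem_erase.2 ⟨hwu, hw⟩)
  obtain ⟨c, hc, hce, huc⟩ := hpos.eq_sub_of_isolated hE hcard hsq hcomp hu he hue hwe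
  have huE : ∀ f ∈ E, negForm N u f = (if f = c then -1 else 0) - if f = e then -1 else 0 :=
    fun f hf => by rw [huc, negForm_sub_left, hE.1.negForm_mem hc hf, hE.1.negForm_mem he hf]
  have hcu : negForm N u c = -1 := by simp [huE c hc, hce]
  have hwc : ∀ w ∈ V, w ≠ u → negForm N w c = negForm N w u := fun w hw hwu => by
    conv_rhs => rw [huc, negForm_sub_right, hwe w hw hwu, sub_zero]
  obtain ⟨v₁, hv₁, v₂, hv₂, hne, h1u, h2u, hv₁u, hv₂u, hnbr⟩ := hpos.exists_neighbors hu
  have hv₁c : negForm N v₁ c = 1 := (hwc v₁ hv₁ h1u).trans hv₁u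
  have hv₂c : negForm N v₂ c = 1 := (hwc v₂ hv₂ h2u).trans hv₂u
  have huv₁ : negForm N u v₁ = 1 := (negForm_comm _ _).trans hv₁u
  have huv₂ : negForm N u v₂ = 1 := (negForm_comm _ _).trans hv₂u
  obtain ⟨a, ha, hva, hva'⟩ := hpos.exists_coefficient hE hv₁
  obtain ⟨b, hb, hvb, hvb'⟩ := hpos.exists_coefficient hE hv₂
  have hac : a ≠ c := by rintro rfl; omega
  have hbc : b ≠ c := by rintro rfl; omega
  have huC := mem_compOf_self hu
  have hv₁C := mem_compOf_of_negForm_ne_zero huC hv₁ (by omega)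
  have hv₂C := mem_compOf_of_negForm_ne_zero huC hv₂ (by omega)
  have hT : ({u, v₁, v₂} : Finset (Fin N → ℤ)).card = 3 :=
    Finset.card_eq_three.2 ⟨u, v₁, v₂, h1u.symm, h2u.symm, hne, rfl⟩
  refine ⟨u, hu, c, hc, .inl hcu, huc, hue, fun w hw hw0 => ?_, fun h3 => ?_, fun h3 => ?_⟩
  · by_contra hwu
    exact hw0 (hwe w hw hwu)
  · have hvw : negForm N v₁ v₂ = 0 := by
      by_contra hvw
      have hsub : compOf N V u ⊆ {u, v₁, v₂} := by
        refine compOf_subset_of_closed (by simp) fun x hx w hw hwx => ?_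
        by_contra hwT
        simp only [Finset.mem_insert, Finset.mem_singleton, not_or] at hx hwT
        obtain ⟨hwu, hw1, hw2⟩ := hwT
        rcases hx with rfl | rfl | rfl
        · exact hwx (hnbr w hw hwu hw1 hw2)
        · exact hwx (hpos.negForm_eq_zero_of_adjacent hv₁ hu hv₂ hw h2u.symm h1u.symm hne.symm
            (by omega) (by rwa [negForm_comm]) hw1 hwu hw2)
        · exact hwx (hpos.negForm_eq_zero_of_adjacent hv₂ hu hv₁ hw h1u.symm h2u.symm hne
            (by omega) hvw hw2 hwu hw1)
      have := Finset.card_le_card hsub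
      omega
    rcases three_le_card_support_of_orthogonal hE.1 ha hb hc hac hbc hva hvb hv₁c hv₂c hvw
      with h | h
    · exact ⟨v₁, hv₁C, hv₁c, h⟩
    · exact ⟨v₂, hv₂C, hv₂c, h⟩
  · have hCeq : compOf N V u = {u, v₁, v₂} := by
      refine (Finset.eq_of_subset_of_card_le (fun x hx => ?_) (by omega)).symm
      simp only [Finset.mem_insert, Finset.mem_singleton] at hx
      rcases hx with rfl | rfl | rfl <;> assumption
    have hCmem : ∀ w, w ∈ compOf N V u ↔ w = u ∨ w = v₁ ∨ w = v₂ := fun w => by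
      rw [hCeq]; simp
    have hout : ∀ x ∈ compOf N V u, ∀ w ∈ V, w ≠ u → w ≠ v₁ → w ≠ v₂ → negForm N w x = 0 := by
      intro x hx w hw hwu hw1 hw2
      by_contra h0
      have := (hCmem w).1 (mem_compOf_of_negForm_ne_zero hx hw h0)
      tauto
    have hvw : negForm N v₁ v₂ = 1 := by
      obtain ⟨x, hx, y, hy, hxy, hx2, hy2, hx', hy', -⟩ := hpos.exists_neighbors hv₂
      have h4 := (hCmem x).1 (mem_compOf_of_negForm_ne_zero hv₂C hx (by omega))
      have h5 := (hCmem y).1 (mem_compOf_of_negForm_ne_zero hv₂C hy (by omega))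
      grind
    have hnorm := hcomp u hu
    rw [h3, hCeq, Finset.sum_insert (by simp [h1u.symm, h2u.symm]), Finset.sum_pair hne,
      hpos.negForm_self_eq_neg_two hE hcard hsq hcomp hu he hue hwe] at hnorm
    have hpq : ∑ f ∈ E, negForm N v₁ f * negForm N v₂ f = -1 := by
      rw [hE.1.negForm_eq] at hvw; linarith
    have hsq7 : ∑ f ∈ E, (negForm N v₁ f ^ 2 + negForm N v₂ f ^ 2) = 7 := by
      rw [hE.1.negForm_eq v₁, hE.1.negForm_eq v₂] at hnorm
      simp only [sq, Finset.sum_add_distrib]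
      push_cast at hnorm
      linarith
    have hshape : ∀ v : Fin N → ℤ, negForm N v c = 1 → ∀ k : ℤ, negForm N v a = -k →
        (∀ f ∈ E, f ≠ c → f ≠ a → negForm N v f = 0) → v = k • a - c := by
      intro v hvc k hk h0
      refine hE.1.ext fun f hf => ?_
      rw [negForm_sub_left, negForm_smul_left, hE.1.negForm_mem ha hf, hE.1.negForm_mem hc hf]
      have := h0 f hf
      grind
    rcases triangle_coefficients ha hb hc hac hbc hv₁c hv₂c hva hvb hva' hvb' hpq hsq7 with
      ⟨-, hval, h0⟩ | ⟨hab, h1, h2, h4, h5, d, hd, hda, hdb, hdc, hdv, h0⟩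
    · refine ⟨c, hc, e, he, a, ha, ?_⟩
      rw [hCeq, ← huc]
      rcases hval with ⟨h1, h2⟩ | ⟨h1, h2⟩
      · rw [hshape v₁ hv₁c 1 h1 fun f hf hc ha => (h0 f hf hc ha).1,
          hshape v₂ hv₂c (-2) (by omega) fun f hf hc ha => (h0 f hf hc ha).2, one_smul]
      · rw [hshape v₁ hv₁c (-2) (by omega) fun f hf hc ha => (h0 f hf hc ha).1,
          hshape v₂ hv₂c 1 h2 fun f hf hc ha => (h0 f hf hc ha).2, one_smul,
          Finset.pair_comm]
    · exfalso
      have hde : d ≠ e := by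
        rintro rfl
        have := hwe v₁ hv₁ h1u
        have := hwe v₂ hv₂ h2u
        omega
      have hud : negForm N u d = 0 := by simp [huE d hd, hdc, hde]
      have hxc : ∀ x ∈ V, x ≠ u → x ≠ v₁ → x ≠ v₂ → negForm N x c = 0 :=
        fun x hx hxu hx1 hx2 => (hwc x hx hxu).trans (hnbr x hx hxu hx1 hx2)
      rcases hdv with ⟨h6, h7⟩ | ⟨h6, h7⟩
      · exact hpos.triangle_excluded hE hcard hsq hcomp hv₂ ha hb hc hd hab hac hbc hda hdb
          hdc hxc (hout v₁ hv₁C) (hout v₂ hv₂C) hud h1 h2 h6 h4 h5 hv₂c h7 h0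
      · exact hpos.triangle_excluded hE hcard hsq hcomp hv₁ hb ha hc hd hab.symm hbc hac hdb
          hda hdc (fun x hx hu h2 h1 => hxc x hx hu h1 h2)
          (fun x hx hu h2 h1 => hout v₂ hv₂C x hx hu h1 h2)
          (fun x hx hu h2 h1 => hout v₁ hv₁C x hx hu h1 h2) hud h5 h4 h7 h2 h1 hv₁c h6
          fun f hf hfb hfa hfc hfd => (h0 f hf hfa hfb hfc hfd).symm
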